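/- Let 1 < q < ∞ and suppose α/n > β/m and (α+ρβ)/(n+ρm) = 1 − 1/q. Then there exists a constant C, depending only on n, m, α, β, ρ, q, such that ‖I a‖_{L^q(ℝ^{n+m})} ≤ C for every H^1-atom a. -/

import Mathlib

open MeasureTheory

/-- The flag kernel `Ω(x,y) = |x|^(α-n) (|x|^ρ + |y|)^(β-m)` on `ℝ^n × ℝ^m`. -/
noncomputable def flagKernel (n m : ℕ) (α β ρ : ℝ)
    (x : EuclideanSpace ℝ (Fin n)) (y : EuclideanSpace ℝ (Fin m)) : ℝ :=
  ‖x‖ ^ (α - (n : ℝ)) * (‖x‖ ^ ρ + ‖y‖) ^ (β - (m : ℝ))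

/-- The fractional integral operator `I f(x,y) = ∬ f(u,v) Ω(x-u, y-v) du dv`. -/
noncomputable def flagOp (n m : ℕ) (α β ρ : ℝ)
    (f : EuclideanSpace ℝ (Fin n) × EuclideanSpace ℝ (Fin m) → ℝ)
    (z : EuclideanSpace ℝ (Fin n) × EuclideanSpace ℝ (Fin m)) : ℝ :=
  ∫ w : EuclideanSpace ℝ (Fin n) × EuclideanSpace ℝ (Fin m),
    f w * flagKernel n m α β ρ (z.1 - w.1) (z.2 - w.2)

/-- An `H¹`-atom: a measurable function supported in an axis-parallel cube `Q`
(center `c`, side length `2r`), bounded by `1/vol(Q)`, with vanishing integral. -/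
def IsH1Atom (n m : ℕ)
    (a : EuclideanSpace ℝ (Fin n) × EuclideanSpace ℝ (Fin m) → ℝ) : Prop :=
  Measurable a ∧
  ∃ (c : EuclideanSpace ℝ (Fin n) × EuclideanSpace ℝ (Fin m)) (r : ℝ), 0 < r ∧
    (∀ w, a w ≠ 0 → (∀ i, |w.1 i - c.1 i| ≤ r) ∧ (∀ j, |w.2 j - c.2 j| ≤ r)) ∧
    (∀ w, |a w| ≤ ((2 * r) ^ (n + m))⁻¹) ∧
    (∫ w : EuclideanSpace ℝ (Fin n) × EuclideanSpace ℝ (Fin m), a w) = 0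

section Radial

open Metric Module

variable {E : Type*} [NormedAddCommGroup E] [NormedSpace ℝ E] [FiniteDimensional ℝ E]
  [MeasurableSpace E] [BorelSpace E] (μ : Measure E) [μ.IsAddHaarMeasure]

lemma lintegral_comp_inv_smul {R : ℝ} (hR : 0 < R) (f : E → ENNReal) (hf : Measurable f) :
    ∫⁻ x, f (R⁻¹ • x) ∂μ = ENNReal.ofReal (R ^ finrank ℝ E) * ∫⁻ x, f x ∂μ := by
  rw [← lintegral_map hf (measurable_const_smul R⁻¹),
    Measure.map_addHaar_smul μ (inv_ne_zero hR.ne'), lintegral_smul_measure, smul_eq_mul]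
  congr 2
  rw [inv_pow, inv_inv, abs_of_pos (pow_pos hR _)]

lemma exists_lintegral_closedBall_norm_rpow_le (hd : 0 < finrank ℝ E) {s : ℝ}
    (hs : -(finrank ℝ E : ℝ) < s) :
    ∃ C : ENNReal, C ≠ ⊤ ∧ ∀ R : ℝ, 0 < R →
      ∫⁻ x in closedBall (0 : E) R, ENNReal.ofReal (‖x‖ ^ s) ∂μ
        ≤ C * ENNReal.ofReal (R ^ (s + finrank ℝ E)) := by
  refine ⟨∫⁻ x in closedBall (0 : E) 1, ENNReal.ofReal (‖x‖ ^ s) ∂μ, ?_, fun R hR => ?_⟩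
  · have h : IntegrableOn (fun x : E => ‖x‖ ^ s) (ball 0 2) μ := by
      refine integrableOn_ball_of_norm_le_rpow (C := 1) (α := -s) hd (by linarith) ?_ ?_
      · refine Filter.Eventually.of_forall fun x => ?_
        rw [neg_neg, one_mul, Real.norm_of_nonneg (by positivity)]
      · exact Measurable.aestronglyMeasurable (by fun_prop)
    have h2 : IntegrableOn (fun x : E => ‖x‖ ^ s) (closedBall 0 1) μ :=
      h.mono_set (closedBall_subset_ball (by norm_num))
    rw [← lt_top_iff_ne_top]
    exact h2.lintegral_lt_top
  · rw [← lintegral_indicator measurableSet_closedBall,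
      ← lintegral_indicator measurableSet_closedBall]
    have hm : Measurable ((closedBall (0 : E) 1).indicator
        fun x => ENNReal.ofReal (‖x‖ ^ s)) := by
      refine Measurable.indicator (by fun_prop) measurableSet_closedBall
    have := lintegral_comp_inv_smul μ hR _ hm
    rw [Real.rpow_add hR, ENNReal.ofReal_mul (by positivity), Real.rpow_natCast, mul_comm,
      mul_assoc, ← this, ← lintegral_const_mul' _ _ ENNReal.ofReal_ne_top]
    refine lintegral_mono fun x => ?_
    by_cases hx : x ∈ closedBall (0 : E) R
    · have hx' : R⁻¹ • x ∈ closedBall (0 : E) 1 := by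
        rw [mem_closedBall_zero_iff] at hx ⊢
        rw [norm_smul, norm_inv, Real.norm_of_nonneg hR.le, inv_mul_le_iff₀ hR]
        simpa using hx
      rw [Set.indicator_of_mem hx, Set.indicator_of_mem hx', ← ENNReal.ofReal_mul (by positivity),
        norm_smul, norm_inv, Real.norm_of_nonneg hR.le, Real.mul_rpow (by positivity)
        (by positivity), ← mul_assoc, ← Real.mul_rpow (by positivity) (by positivity),
        mul_inv_cancel₀ hR.ne', Real.one_rpow, one_mul]
    · rw [Set.indicator_of_notMem hx]
      exact zero_le

lemma exists_lintegral_add_norm_rpow_le {s : ℝ} (hs : s < -(finrank ℝ E : ℝ)) :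
    ∃ C : ENNReal, C ≠ ⊤ ∧ ∀ R : ℝ, 0 < R →
      ∫⁻ x : E, ENNReal.ofReal ((R + ‖x‖) ^ s) ∂μ
        ≤ C * ENNReal.ofReal (R ^ (s + finrank ℝ E)) := by
  refine ⟨∫⁻ x : E, ENNReal.ofReal ((1 + ‖x‖) ^ s) ∂μ, ?_, fun R hR => ?_⟩
  · have := finite_integral_one_add_norm (E := E) (μ := μ) (r := -s) (by linarith)
    rw [neg_neg] at this
    exact this.ne
  · have hm : Measurable fun x : E => ENNReal.ofReal ((1 + ‖x‖) ^ s) := by fun_prop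
    have := lintegral_comp_inv_smul μ hR _ hm
    rw [Real.rpow_add hR, ENNReal.ofReal_mul (by positivity), Real.rpow_natCast, mul_comm,
      mul_assoc, ← this, ← lintegral_const_mul _ (by fun_prop)]
    refine lintegral_mono fun x => ?_
    rw [← ENNReal.ofReal_mul (by positivity), ← Real.mul_rpow (by positivity) (by positivity),
      norm_smul, norm_inv, Real.norm_of_nonneg hR.le, mul_add, mul_one,
      mul_inv_cancel_left₀ hR.ne']

lemma exists_lintegral_compl_closedBall_norm_rpow_le {s : ℝ}
    (hs : s < -(finrank ℝ E : ℝ)) :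
    ∃ C : ENNReal, C ≠ ⊤ ∧ ∀ R : ℝ, 0 < R →
      ∫⁻ x in (closedBall (0 : E) R)ᶜ, ENNReal.ofReal (‖x‖ ^ s) ∂μ
        ≤ C * ENNReal.ofReal (R ^ (s + finrank ℝ E)) := by
  obtain ⟨C, hC, h⟩ := exists_lintegral_add_norm_rpow_le μ hs
  have hs0 : s ≤ 0 := hs.le.trans (by simp)
  refine ⟨ENNReal.ofReal (2⁻¹ ^ s) * C, ENNReal.mul_ne_top ENNReal.ofReal_ne_top hC,
    fun R hR => ?_⟩
  rw [mul_assoc]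
  refine le_trans ?_ (mul_le_mul_right (h R hR) _)
  rw [← lintegral_const_mul _ (by fun_prop)]
  refine (setLIntegral_mono' measurableSet_closedBall.compl fun x hx => ?_).trans
    (setLIntegral_le_lintegral _ _)
  rw [← ENNReal.ofReal_mul (by positivity), ← Real.mul_rpow (by positivity) (by positivity)]
  refine ENNReal.ofReal_le_ofReal (Real.rpow_le_rpow_of_nonpos (by positivity) ?_ hs0)
  simp at hx
  linarith

lemma exists_lintegral_closedBall_one_add_rpow_le (hd : 0 < finrank ℝ E) {s : ℝ}
    (hs : -(finrank ℝ E : ℝ) < s) (hs0 : s < 0) :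
    ∃ C : ENNReal, C ≠ ⊤ ∧ ∀ r : ℝ, 0 < r → ∀ c x : E,
      ∫⁻ u in closedBall c r, ENNReal.ofReal (1 + (‖x - u‖ / r) ^ s) ∂μ
        ≤ C * ENNReal.ofReal (r ^ finrank ℝ E) := by
  obtain ⟨C, hC, h⟩ := exists_lintegral_closedBall_norm_rpow_le μ hd hs
  refine ⟨2 * μ (ball 0 1) + C, ENNReal.add_ne_top.2 ⟨ENNReal.mul_ne_top (by simp)
    measure_ball_lt_top.ne, hC⟩, fun r hr c x => ?_⟩
  set g : E → ENNReal := (closedBall (0 : E) r).indicator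
    fun u => ENNReal.ofReal (r ^ (-s)) * ENNReal.ofReal (‖u‖ ^ s) with hg
  have hgm : Measurable g := Measurable.indicator (by fun_prop) measurableSet_closedBall
  have hpt (u : E) : ENNReal.ofReal (1 + (‖x - u‖ / r) ^ s) ≤ 2 + g (x - u) := by
    by_cases hu : x - u ∈ closedBall (0 : E) r
    · rw [hg, Set.indicator_of_mem hu, ← ENNReal.ofReal_mul (by positivity),
        ENNReal.ofReal_add (by norm_num) (by positivity), Real.rpow_neg hr.le, inv_mul_eq_div,
        Real.div_rpow (norm_nonneg _) hr.le]
      gcongr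
      simp
    · have : (‖x - u‖ / r) ^ s ≤ 1 := by
        refine Real.rpow_le_one_of_one_le_of_nonpos ?_ hs0.le
        rw [one_le_div hr]
        simp at hu
        exact hu.le
      refine le_trans ?_ le_self_add
      rw [← ENNReal.ofReal_ofNat]
      exact ENNReal.ofReal_le_ofReal (by linarith)
  calc ∫⁻ u in closedBall c r, ENNReal.ofReal (1 + (‖x - u‖ / r) ^ s) ∂μ
      ≤ ∫⁻ u in closedBall c r, (2 + g (x - u)) ∂μ := lintegral_mono fun u => hpt u
    _ ≤ 2 * μ (closedBall c r) + ∫⁻ u, g u ∂μ := by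
        rw [lintegral_add_left (by fun_prop), setLIntegral_const]
        refine add_le_add le_rfl ((setLIntegral_le_lintegral _ _).trans_eq ?_)
        exact lintegral_sub_left_eq_self g x
    _ ≤ _ := by
        rw [hg, lintegral_indicator measurableSet_closedBall,
          lintegral_const_mul _ (by fun_prop), Measure.addHaar_closedBall μ c hr.le, add_mul]
        refine add_le_add (le_of_eq (by ring)) ?_
        refine (mul_le_mul_right (h r hr) _).trans_eq ?_
        rw [mul_left_comm, ← ENNReal.ofReal_mul (by positivity), ← Real.rpow_add hr,
          neg_add_cancel_left, Real.rpow_natCast]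

end Radial

section Weighted

variable {Z W : Type*} [MeasurableSpace Z] [MeasurableSpace W]

/-- A weighted form of Jensen's inequality. -/
lemma rpow_lintegral_mul_le (μ : Measure W) {q : ℝ} (hq : 1 < q) {b F H : W → ENNReal}
    (hb : Measurable b) (hF : Measurable F) (hH : Measurable H)
    (hH0 : ∀ w, H w ≠ 0) (hHt : ∀ w, H w ≠ ⊤) :
    (∫⁻ w, b w * F w ∂μ) ^ q
      ≤ (∫⁻ w, b w * H w ∂μ) ^ (q - 1) * ∫⁻ w, b w * (F w ^ q * H w ^ (1 - q)) ∂μ := by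
  have hq0 : 0 < q := by linarith
  have hq1 : 0 ≤ 1 - 1 / q := by
    rw [sub_nonneg, div_le_one hq0]; exact hq.le
  have hpt (w : W) : b w * F w
      = (b w * H w) ^ (1 - 1 / q) * (b w * (F w ^ q * H w ^ (1 - q))) ^ (1 / q) := by
    rw [ENNReal.mul_rpow_of_nonneg _ _ hq1, ENNReal.mul_rpow_of_nonneg _ _ (by positivity),
      ENNReal.mul_rpow_of_nonneg _ _ (by positivity), ← ENNReal.rpow_mul, ← ENNReal.rpow_mul,
      mul_one_div_cancel hq0.ne', ENNReal.rpow_one]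
    have h1 : b w ^ (1 - 1 / q) * b w ^ (1 / q) = b w := by
      rw [← ENNReal.rpow_add_of_nonneg _ _ hq1 (by positivity), sub_add_cancel, ENNReal.rpow_one]
    have h2 : H w ^ (1 - 1 / q) * H w ^ ((1 - q) * (1 / q)) = 1 := by
      rw [← ENNReal.rpow_add _ _ (hH0 w) (hHt w)]
      have : 1 - 1 / q + (1 - q) * (1 / q) = 0 := by field_simp; ring
      rw [this, ENNReal.rpow_zero]
    calc b w * F w = (b w ^ (1 - 1 / q) * b w ^ (1 / q))
          * (H w ^ (1 - 1 / q) * H w ^ ((1 - q) * (1 / q))) * F w := by rw [h1, h2, mul_one]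
      _ = _ := by ring
  have key := ENNReal.lintegral_mul_norm_pow_le (μ := μ) (f := fun w => b w * H w)
    (g := fun w => b w * (F w ^ q * H w ^ (1 - q))) (hb.mul hH).aemeasurable
    (hb.mul ((hF.pow_const _).mul (hH.pow_const _))).aemeasurable hq1
    (by positivity : 0 ≤ 1 / q) (by ring)
  calc (∫⁻ w, b w * F w ∂μ) ^ q
      ≤ ((∫⁻ w, b w * H w ∂μ) ^ (1 - 1 / q)
          * (∫⁻ w, b w * (F w ^ q * H w ^ (1 - q)) ∂μ) ^ (1 / q)) ^ q := by
        refine ENNReal.rpow_le_rpow ?_ hq0.le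
        simp_rw [hpt]
        exact key
    _ = _ := by
        rw [ENNReal.mul_rpow_of_nonneg _ _ hq0.le, ← ENNReal.rpow_mul, ← ENNReal.rpow_mul,
          one_div_mul_cancel hq0.ne', ENNReal.rpow_one, sub_mul, one_mul,
          one_div_mul_cancel hq0.ne']

/-- A Schur-type test with weight `H`. -/
lemma setLIntegral_rpow_lintegral_mul_le (ν : Measure Z) (μ : Measure W) [SFinite ν] [SFinite μ]
    {q : ℝ} (hq : 1 < q) {b : W → ENNReal} {F H : Z → W → ENNReal} (hb : Measurable b)
    (hF : Measurable (Function.uncurry F)) (hH : Measurable (Function.uncurry H))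
    (hH0 : ∀ z w, H z w ≠ 0) (hHt : ∀ z w, H z w ≠ ⊤) {S : Set Z} {A B M : ENNReal}
    (hA : ∀ z, ∫⁻ w, b w * H z w ∂μ ≤ A)
    (hB : ∀ w, b w ≠ 0 → ∫⁻ z in S, F z w ^ q * H z w ^ (1 - q) ∂ν ≤ B)
    (hM : ∫⁻ w, b w ∂μ ≤ M) :
    ∫⁻ z in S, (∫⁻ w, b w * F z w ∂μ) ^ q ∂ν ≤ A ^ (q - 1) * (M * B) := by
  have hG : Measurable (Function.uncurry fun z w => b w * (F z w ^ q * H z w ^ (1 - q))) :=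
    (hb.comp measurable_snd).mul ((hF.pow_const _).mul (hH.pow_const _))
  calc ∫⁻ z in S, (∫⁻ w, b w * F z w ∂μ) ^ q ∂ν
      ≤ ∫⁻ z in S, A ^ (q - 1) * ∫⁻ w, b w * (F z w ^ q * H z w ^ (1 - q)) ∂μ ∂ν := by
        refine lintegral_mono fun z => (rpow_lintegral_mul_le μ hq hb
          (hF.comp measurable_prodMk_left) (hH.comp measurable_prodMk_left)
          (hH0 z) (hHt z)).trans ?_
        exact mul_le_mul_left (ENNReal.rpow_le_rpow (hA z) (by linarith)) _
    _ = A ^ (q - 1) * ∫⁻ w, b w * ∫⁻ z in S, F z w ^ q * H z w ^ (1 - q) ∂ν ∂μ := by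
        have hG' : Measurable fun z => ∫⁻ w, b w * (F z w ^ q * H z w ^ (1 - q)) ∂μ :=
          hG.lintegral_prod_right'
        rw [lintegral_const_mul _ hG',
          lintegral_lintegral_swap hG.aemeasurable]
        congr 1
        refine lintegral_congr fun w => lintegral_const_mul _ ?_
        exact ((hF.comp measurable_prodMk_right).pow_const _).mul
          ((hH.comp measurable_prodMk_right).pow_const _)
    _ ≤ A ^ (q - 1) * ∫⁻ w, b w * B ∂μ := by
        refine mul_le_mul_right (lintegral_mono fun w => ?_) _
        by_cases hw : b w = 0
        · simp [hw]
        · exact mul_le_mul_right (hB w hw) _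
    _ ≤ _ := by
        rw [lintegral_mul_const _ hb]
        gcongr

end Weighted

section Difference

/-- Powers are Lipschitz on the scale of the argument. -/
lemma exists_abs_rpow_sub_rpow_le (γ : ℝ) {κ : ℝ} (hκ : 1 ≤ κ) :
    ∃ C : ℝ, 0 ≤ C ∧ ∀ a b : ℝ, 0 < a → a ≤ κ * b → b ≤ κ * a →
      |b ^ γ - a ^ γ| ≤ C * (|b - a| / a) * a ^ γ := by
  have hκ0 : 0 < κ := by linarith
  have hd : ContDiffOn ℝ 1 (fun t : ℝ => t ^ γ) (Set.Icc κ⁻¹ κ) := fun t ht =>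
    (Real.contDiffAt_rpow_const (Or.inl ((inv_pos.2 hκ0).trans_le ht.1).ne')).contDiffWithinAt
  obtain ⟨K, hK⟩ := hd.exists_lipschitzOnWith one_ne_zero (convex_Icc _ _) isCompact_Icc
  refine ⟨K, K.2, fun a b ha hab hba => ?_⟩
  have hb : 0 < b := pos_of_mul_pos_right (ha.trans_le hab) hκ0.le
  have h1 : (1 : ℝ) ∈ Set.Icc κ⁻¹ κ := ⟨inv_le_one_of_one_le₀ hκ, hκ⟩
  have h2 : b / a ∈ Set.Icc κ⁻¹ κ :=
    ⟨by rw [le_div_iff₀ ha, inv_mul_le_iff₀ hκ0]; exact hab, by rwa [div_le_iff₀ ha]⟩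
  have h3 := hK.dist_le_mul _ h2 _ h1
  rw [Real.dist_eq, Real.dist_eq, Real.one_rpow] at h3
  have e1 : b ^ γ - a ^ γ = ((b / a) ^ γ - 1) * a ^ γ := by
    rw [Real.div_rpow hb.le ha.le, sub_mul, div_mul_cancel₀ _ (Real.rpow_pos_of_pos ha _).ne',
      one_mul]
  have e2 : |b / a - 1| = |b - a| / a := by
    rw [div_sub_one ha.ne', abs_div, abs_of_pos ha]
  rw [e1, abs_mul, abs_of_pos (Real.rpow_pos_of_pos ha γ), ← e2]
  gcongr

lemma exists_abs_flagKernel_sub_le (n m : ℕ) (α β : ℝ) {ρ : ℝ} (hρ : 1 ≤ ρ) :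
    ∃ C : ℝ, 0 ≤ C ∧ ∀ (t : ℝ) (x u : EuclideanSpace ℝ (Fin n)) (y v : EuclideanSpace ℝ (Fin m)),
      0 < t → ‖u‖ ≤ t → ‖v‖ ≤ t ^ ρ → 2 * t < ‖x‖ →
      |flagKernel n m α β ρ (x - u) (y - v) - flagKernel n m α β ρ x y|
        ≤ C * (t / ‖x‖ * flagKernel n m α β ρ x y) := by
  obtain ⟨C₁, hC₁, h₁⟩ := exists_abs_rpow_sub_rpow_le (α - n) one_le_two
  obtain ⟨C₂, hC₂, h₂⟩ := exists_abs_rpow_sub_rpow_le ρ one_le_two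
  have hκ : (1 : ℝ) ≤ 2 ^ ρ + 1 := by
    have : (0 : ℝ) < 2 ^ ρ := by positivity
    linarith
  obtain ⟨C₃, hC₃, h₃⟩ := exists_abs_rpow_sub_rpow_le (β - m) hκ
  set C₄ := C₃ * (C₂ + 1) with hC₄
  have hC₄0 : 0 ≤ C₄ := by positivity
  refine ⟨C₁ * (1 + C₄) + C₄, by positivity, fun t x u y v ht hu hv hx => ?_⟩
  unfold flagKernel
  have hs : 0 < ‖x‖ := by linarith
  have hsu : |‖x - u‖ - ‖x‖| ≤ t := by
    have := abs_norm_sub_norm_le (x - u) x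
    rw [sub_sub_cancel_left, norm_neg] at this
    exact this.trans hu
  have hyv : |‖y - v‖ - ‖y‖| ≤ t ^ ρ := by
    have := abs_norm_sub_norm_le (y - v) y
    rw [sub_sub_cancel_left, norm_neg] at this
    exact this.trans hv
  generalize ‖x - u‖ = s' at *
  generalize ‖x‖ = s at *
  have hτ : 0 ≤ ‖y‖ := norm_nonneg _
  have hτ' : 0 ≤ ‖y - v‖ := norm_nonneg _
  generalize ‖y - v‖ = τ' at *
  generalize ‖y‖ = τ at *
  have hsu' := abs_le.1 hsu
  have hyv' := abs_le.1 hyv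
  have hs' : 0 < s' := by linarith
  have hρ0 : 0 ≤ ρ := by linarith
  have hts : t / s ≤ 1 := by rw [div_le_one hs]; linarith
  have hts0 : 0 ≤ t / s := by positivity
  have hss : s ^ ρ ≤ 2 ^ ρ * s' ^ ρ := by
    rw [← Real.mul_rpow (by norm_num) hs'.le]
    exact Real.rpow_le_rpow hs.le (by linarith) hρ0
  have hss' : s' ^ ρ ≤ 2 ^ ρ * s ^ ρ := by
    rw [← Real.mul_rpow (by norm_num) hs.le]
    exact Real.rpow_le_rpow hs'.le (by linarith) hρ0
  have hts' : t ^ ρ ≤ s' ^ ρ := Real.rpow_le_rpow ht.le (by linarith) hρ0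
  have htρ : t ^ ρ ≤ t / s * s ^ ρ := by
    calc t ^ ρ = (t / s) ^ ρ * s ^ ρ := by
          rw [Real.div_rpow ht.le hs.le, div_mul_cancel₀ _ (Real.rpow_pos_of_pos hs _).ne']
      _ ≤ t / s * s ^ ρ := by
          gcongr
          exact (Real.rpow_le_rpow_of_exponent_ge (by positivity) hts hρ).trans_eq
            (Real.rpow_one _)
  have htρ' : t ^ ρ ≤ s ^ ρ := htρ.trans (mul_le_of_le_one_left (by positivity) hts)
  have hsp : 0 < s ^ ρ := Real.rpow_pos_of_pos hs _
  have hsp' : 0 < s' ^ ρ := Real.rpow_pos_of_pos hs' _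
  have h2p : (0 : ℝ) < 2 ^ ρ := by positivity
  have d₁ : |s' ^ (α - n) - s ^ (α - n)| ≤ C₁ * (t / s) * s ^ (α - n) := by
    refine (h₁ s s' hs (by linarith) (by linarith)).trans ?_
    gcongr
  have d₂ : |s' ^ ρ - s ^ ρ| ≤ C₂ * (t / s) * s ^ ρ := by
    refine (h₂ s s' hs (by linarith) (by linarith)).trans ?_
    gcongr
  have hD : 0 < s ^ ρ + τ := by positivity
  have d₃ : |(s' ^ ρ + τ') - (s ^ ρ + τ)| ≤ (C₂ + 1) * (t / s) * (s ^ ρ + τ) := by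
    calc |(s' ^ ρ + τ') - (s ^ ρ + τ)| = |(s' ^ ρ - s ^ ρ) + (τ' - τ)| := by ring_nf
      _ ≤ |s' ^ ρ - s ^ ρ| + |τ' - τ| := abs_add_le _ _
      _ ≤ C₂ * (t / s) * s ^ ρ + t / s * s ^ ρ := add_le_add d₂ (hyv.trans htρ)
      _ = (C₂ + 1) * (t / s) * s ^ ρ := by ring
      _ ≤ _ := by gcongr; linarith
  have d₄ : |(s' ^ ρ + τ') ^ (β - m) - (s ^ ρ + τ) ^ (β - m)|
      ≤ C₄ * (t / s) * (s ^ ρ + τ) ^ (β - m) := by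
    refine (h₃ (s ^ ρ + τ) (s' ^ ρ + τ') hD ?_ ?_).trans ?_
    · nlinarith [mul_nonneg h2p.le hτ']
    · nlinarith [mul_nonneg h2p.le hτ]
    · have e : |(s' ^ ρ + τ') - (s ^ ρ + τ)| / (s ^ ρ + τ) ≤ (C₂ + 1) * (t / s) := by
        rwa [div_le_iff₀ hD]
      have e' : C₄ * (t / s) = C₃ * ((C₂ + 1) * (t / s)) := by rw [hC₄]; ring
      rw [e']
      exact mul_le_mul_of_nonneg_right (mul_le_mul_of_nonneg_left e hC₃) (by positivity)
  have d₅ : (s' ^ ρ + τ') ^ (β - m) ≤ (1 + C₄) * (s ^ ρ + τ) ^ (β - m) := by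
    have e : C₄ * (t / s) * (s ^ ρ + τ) ^ (β - m) ≤ C₄ * 1 * (s ^ ρ + τ) ^ (β - m) := by
      gcongr
    linarith [le_of_abs_le d₄]
  have hP : 0 ≤ (s ^ ρ + τ) ^ (β - m) := by positivity
  have hP' : 0 ≤ (s' ^ ρ + τ') ^ (β - m) := by positivity
  have hQ : 0 ≤ s ^ (α - n) := by positivity
  generalize (s ^ ρ + τ) ^ (β - m) = P at *
  generalize (s' ^ ρ + τ') ^ (β - m) = P' at *
  generalize s ^ (α - n) = Q at *
  generalize s' ^ (α - n) = Q' at *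
  calc |Q' * P' - Q * P| = |(Q' - Q) * P' + Q * (P' - P)| := by ring_nf
    _ ≤ |(Q' - Q) * P'| + |Q * (P' - P)| := abs_add_le _ _
    _ = |Q' - Q| * P' + Q * |P' - P| := by
        rw [abs_mul, abs_mul, abs_of_nonneg hP', abs_of_nonneg hQ]
    _ ≤ C₁ * (t / s) * Q * ((1 + C₄) * P) + Q * (C₄ * (t / s) * P) := by gcongr
    _ = _ := by ring

end Difference

section Kernel

open Metric Module

variable {n m : ℕ} {α β ρ : ℝ}

lemma flagKernel_nonneg (x : EuclideanSpace ℝ (Fin n)) (y : EuclideanSpace ℝ (Fin m)) :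
    0 ≤ flagKernel n m α β ρ x y := by
  unfold flagKernel
  positivity

lemma measurable_flagKernel : Measurable fun z : EuclideanSpace ℝ (Fin n) ×
    EuclideanSpace ℝ (Fin m) => flagKernel n m α β ρ z.1 z.2 := by
  unfold flagKernel
  fun_prop

lemma flagKernel_zero_left (hα : α < n) (y : EuclideanSpace ℝ (Fin m)) :
    flagKernel n m α β ρ 0 y = 0 := by
  unfold flagKernel
  rw [norm_zero, Real.zero_rpow (by linarith), zero_mul]

/-- The `L^q` norm of the kernel in the second variable. -/
lemma exists_lintegral_flagKernel_rpow_le {q : ℝ} (hq : 0 < q)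
    (hβ : (β - m) * q < -(m : ℝ)) (hα : α < n)
    (hhom : (α - n) * q + ρ * ((β - m) * q + m) = -n) :
    ∃ C : ENNReal, C ≠ ⊤ ∧ ∀ x : EuclideanSpace ℝ (Fin n),
      ∫⁻ y : EuclideanSpace ℝ (Fin m), ENNReal.ofReal (flagKernel n m α β ρ x y) ^ q
        ≤ C * ENNReal.ofReal (‖x‖ ^ (-(n : ℝ))) := by
  obtain ⟨C, hC, h⟩ := exists_lintegral_add_norm_rpow_le
    (volume : Measure (EuclideanSpace ℝ (Fin m))) (s := (β - m) * q) (by simpa using hβ)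
  refine ⟨C, hC, fun x => ?_⟩
  rcases eq_or_ne x 0 with rfl | hx
  · simp [flagKernel_zero_left hα, hq]
  have hx' : 0 < ‖x‖ := norm_pos_iff.2 hx
  have hxρ : 0 < ‖x‖ ^ ρ := Real.rpow_pos_of_pos hx' _
  have e (y : EuclideanSpace ℝ (Fin m)) : ENNReal.ofReal (flagKernel n m α β ρ x y) ^ q
      = ENNReal.ofReal (‖x‖ ^ ((α - n) * q))
        * ENNReal.ofReal ((‖x‖ ^ ρ + ‖y‖) ^ ((β - m) * q)) := by
    rw [ENNReal.ofReal_rpow_of_nonneg (flagKernel_nonneg _ _) hq.le, flagKernel,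
      Real.mul_rpow (by positivity) (by positivity), ENNReal.ofReal_mul (by positivity),
      ← Real.rpow_mul (by positivity), ← Real.rpow_mul (by positivity)]
  simp_rw [e]
  rw [lintegral_const_mul _ (by fun_prop)]
  refine (mul_le_mul_right (h _ hxρ) _).trans_eq ?_
  rw [mul_left_comm, ← ENNReal.ofReal_mul (by positivity), ← Real.rpow_mul hx'.le,
    ← Real.rpow_add hx', finrank_euclideanSpace_fin, hhom]

lemma setLIntegral_comp_sub_le {S T : Set (EuclideanSpace ℝ (Fin n))} (hS : MeasurableSet S)
    (hT : MeasurableSet T) (w : EuclideanSpace ℝ (Fin n) × EuclideanSpace ℝ (Fin m))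
    (hST : ∀ x ∈ S, x - w.1 ∈ T)
    {G : EuclideanSpace ℝ (Fin n) × EuclideanSpace ℝ (Fin m) → ENNReal} (hG : Measurable G) :
    ∫⁻ z in Prod.fst ⁻¹' S, G (z - w) ≤ ∫⁻ x in T, ∫⁻ y, G (x, y) := by
  have hm : Measurable ((Prod.fst ⁻¹' T).indicator G) := hG.indicator (measurable_fst hT)
  calc ∫⁻ z in Prod.fst ⁻¹' S, G (z - w)
      ≤ ∫⁻ z, (Prod.fst ⁻¹' T).indicator G (z - w) := by
        rw [← lintegral_indicator (measurable_fst hS)]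
        refine lintegral_mono fun z => ?_
        by_cases hz : z.1 ∈ S
        · rw [Set.indicator_of_mem (by exact hz), Set.indicator_of_mem (by exact hST _ hz)]
        · rw [Set.indicator_of_notMem (by exact hz)]
          exact zero_le
    _ = ∫⁻ z, (Prod.fst ⁻¹' T).indicator G z := by
        rw [Measure.volume_eq_prod]
        exact lintegral_sub_right_eq_self _ w
    _ = ∫⁻ x in T, ∫⁻ y, G (x, y) := by
        rw [Measure.volume_eq_prod, lintegral_prod _ hm.aemeasurable, ← lintegral_indicator hT]
        refine lintegral_congr fun x => ?_
        by_cases hx : x ∈ T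
        · rw [Set.indicator_of_mem hx]
          refine lintegral_congr fun y => ?_
          rw [Set.indicator_of_mem (by exact hx)]
        · rw [Set.indicator_of_notMem hx]
          simp [Set.indicator, hx]

/-- If `b` is bounded by `M r^{-(n+m)}` on a product of two balls of radius `r` and vanishes
elsewhere, then it averages products of functions of one variable. -/
lemma lintegral_mul_prod_le {M r : ℝ} (hM : 0 ≤ M) (hr : 0 < r)
    {c : EuclideanSpace ℝ (Fin n) × EuclideanSpace ℝ (Fin m)}
    {b : EuclideanSpace ℝ (Fin n) × EuclideanSpace ℝ (Fin m) → ENNReal}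
    (hb : ∀ w, b w ≤ ENNReal.ofReal (M * (r ^ (n + m))⁻¹))
    (hsupp : ∀ w, b w ≠ 0 → w ∈ closedBall c.1 r ×ˢ closedBall c.2 r)
    {G : EuclideanSpace ℝ (Fin n) → ENNReal} {G' : EuclideanSpace ℝ (Fin m) → ENNReal}
    (hG : Measurable G) (hG' : Measurable G') {C C' : ENNReal}
    (hC : ∫⁻ u in closedBall c.1 r, G u ≤ C * ENNReal.ofReal (r ^ n))
    (hC' : ∫⁻ v in closedBall c.2 r, G' v ≤ C' * ENNReal.ofReal (r ^ m)) :
    ∫⁻ w, b w * (G w.1 * G' w.2) ≤ ENNReal.ofReal M * (C * C') := by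
  have hms : MeasurableSet (closedBall c.1 r ×ˢ closedBall c.2 r) :=
    measurableSet_closedBall.prod measurableSet_closedBall
  calc ∫⁻ w, b w * (G w.1 * G' w.2)
      ≤ ∫⁻ w in closedBall c.1 r ×ˢ closedBall c.2 r,
          ENNReal.ofReal (M * (r ^ (n + m))⁻¹) * (G w.1 * G' w.2) := by
        rw [← lintegral_indicator hms]
        refine lintegral_mono fun w => ?_
        by_cases hw : b w = 0
        · simp [hw]
        · rw [Set.indicator_of_mem (hsupp w hw)]
          exact mul_le_mul_left (hb w) _
    _ = ENNReal.ofReal (M * (r ^ (n + m))⁻¹)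
          * ((∫⁻ u in closedBall c.1 r, G u) * ∫⁻ v in closedBall c.2 r, G' v) := by
        rw [lintegral_const_mul _ (by fun_prop), Measure.volume_eq_prod, ← Measure.prod_restrict,
          lintegral_prod_mul hG.aemeasurable hG'.aemeasurable]
    _ ≤ ENNReal.ofReal (M * (r ^ (n + m))⁻¹)
          * ((C * ENNReal.ofReal (r ^ n)) * (C' * ENNReal.ofReal (r ^ m))) := by gcongr
    _ = ENNReal.ofReal (M * (r ^ (n + m))⁻¹) * ENNReal.ofReal (r ^ n * r ^ m) * (C * C') := by
        rw [ENNReal.ofReal_mul (by positivity : 0 ≤ r ^ n)]; ring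
    _ = _ := by
        rw [← ENNReal.ofReal_mul (by positivity), ← pow_add, inv_mul_cancel_right₀ (by positivity)]

lemma setLIntegral_one_closedBall_le {d : ℕ} (hd : 0 < d) {r : ℝ} (hr : 0 < r)
    (c : EuclideanSpace ℝ (Fin d)) :
    ∫⁻ _ in closedBall c r, (1 : ENNReal)
      ≤ volume (ball (0 : EuclideanSpace ℝ (Fin d)) 1) * ENNReal.ofReal (r ^ d) := by
  have : Nonempty (Fin d) := ⟨⟨0, hd⟩⟩
  rw [setLIntegral_const, one_mul, Measure.addHaar_closedBall _ c hr.le,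
    finrank_euclideanSpace_fin, mul_comm]

lemma measurable_comp_sub {X : Type*} [MeasurableSpace X]
    {G : EuclideanSpace ℝ (Fin n) × EuclideanSpace ℝ (Fin m) → X} (hG : Measurable G) :
    Measurable (Function.uncurry fun z w : EuclideanSpace ℝ (Fin n) × EuclideanSpace ℝ (Fin m) =>
      G (z - w)) :=
  hG.comp (measurable_fst.sub measurable_snd)

lemma ofReal_rpow_one_sub {x q : ℝ} (hx : 0 < x) :
    ENNReal.ofReal x ^ (1 - q) = ENNReal.ofReal (x ^ (1 - q)) :=
  ENNReal.ofReal_rpow_of_pos hx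

/-- Estimate close to the support in the first variable, at distances comparable to the size of
the support. -/
lemma exists_lintegral_near_le (hn : 0 < n) (hm : 0 < m) (hα : 0 < α) (hαn : α < n) {q : ℝ}
    (hq : 1 < q) (hβq : (β - m) * q < -(m : ℝ))
    (hhom : (α - n) * q + ρ * ((β - m) * q + m) = -n) {M : ℝ} (hM : 0 ≤ M) :
    ∃ C : ENNReal, C ≠ ⊤ ∧ ∀ (c : EuclideanSpace ℝ (Fin n) × EuclideanSpace ℝ (Fin m)) (r : ℝ)
      (b : EuclideanSpace ℝ (Fin n) × EuclideanSpace ℝ (Fin m) → ENNReal), 0 < r → Measurable b →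
      (∀ w, b w ≤ ENNReal.ofReal (M * (r ^ (n + m))⁻¹)) →
      (∀ w, b w ≠ 0 → w ∈ closedBall c.1 r ×ˢ closedBall c.2 r) →
      ∫⁻ z in Prod.fst ⁻¹' closedBall c.1 (2 * r),
        (∫⁻ w, b w * ENNReal.ofReal (flagKernel n m α β ρ (z - w).1 (z - w).2)) ^ q ≤ C := by
  have hq0 : 0 < q := by linarith
  obtain ⟨C₁, hC₁, h₁⟩ := exists_lintegral_closedBall_one_add_rpow_le
    (volume : Measure (EuclideanSpace ℝ (Fin n))) (by simpa using hn) (s := α - n)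
    (by simp; linarith) (by linarith)
  obtain ⟨C₂, hC₂, h₂⟩ := exists_lintegral_flagKernel_rpow_le (n := n) (m := m) (α := α) hq0 hβq
    hαn hhom
  set σ := (α - n) * (1 - q) with hσ
  have hσ0 : 0 < σ := by rw [hσ]; nlinarith
  obtain ⟨C₃, hC₃, h₃⟩ := exists_lintegral_closedBall_norm_rpow_le
    (volume : Measure (EuclideanSpace ℝ (Fin n))) (by simpa using hn) (s := -n + σ)
    (by simp; linarith)
  simp only [finrank_euclideanSpace_fin] at h₁ h₃
  set V := volume (ball (0 : EuclideanSpace ℝ (Fin m)) 1) with hV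
  have hVt : V ≠ ⊤ := measure_ball_lt_top.ne
  set A := ENNReal.ofReal M * (C₁ * V) with hA
  have hAt : A ≠ ⊤ := ENNReal.mul_ne_top ENNReal.ofReal_ne_top (ENNReal.mul_ne_top hC₁ hVt)
  set B := C₂ * (C₃ * ENNReal.ofReal (3 ^ σ)) with hB
  have hBt : B ≠ ⊤ := ENNReal.mul_ne_top hC₂ (ENNReal.mul_ne_top hC₃ ENNReal.ofReal_ne_top)
  refine ⟨A ^ (q - 1) * (A * B), ENNReal.mul_ne_top
    (ENNReal.rpow_ne_top_of_nonneg (by linarith) hAt) (ENNReal.mul_ne_top hAt hBt),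
    fun c r b hr hbm hb hsupp => ?_⟩
  have hHm : Measurable fun z : EuclideanSpace ℝ (Fin n) × EuclideanSpace ℝ (Fin m) =>
      ENNReal.ofReal (1 + (‖z.1‖ / r) ^ (α - n)) := by fun_prop
  have hKm : Measurable fun z : EuclideanSpace ℝ (Fin n) × EuclideanSpace ℝ (Fin m) =>
      ENNReal.ofReal (flagKernel n m α β ρ z.1 z.2) := measurable_flagKernel.ennreal_ofReal
  have hAle (z : EuclideanSpace ℝ (Fin n) × EuclideanSpace ℝ (Fin m)) :
      ∫⁻ w, b w * ENNReal.ofReal (1 + (‖(z - w).1‖ / r) ^ (α - n)) ≤ A := by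
    have := lintegral_mul_prod_le hM hr hb hsupp
      (G := fun u => ENNReal.ofReal (1 + (‖z.1 - u‖ / r) ^ (α - n))) (G' := fun _ => 1)
      (by fun_prop) (by fun_prop) (h₁ r hr c.1 z.1) (setLIntegral_one_closedBall_le hm hr c.2)
    simpa using this
  refine setLIntegral_rpow_lintegral_mul_le volume volume hq hbm (measurable_comp_sub hKm)
    (measurable_comp_sub hHm) (fun z w => ?_) (fun z w => ENNReal.ofReal_ne_top) hAle
    (fun w hw => ?_) ?_
  · exact (ENNReal.ofReal_pos.2 (by positivity)).ne'
  · have hw' := hsupp w hw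
    have hGm : Measurable fun z : EuclideanSpace ℝ (Fin n) × EuclideanSpace ℝ (Fin m) =>
      ENNReal.ofReal (flagKernel n m α β ρ z.1 z.2) ^ q *
        ENNReal.ofReal (1 + (‖z.1‖ / r) ^ (α - n)) ^ (1 - q) :=
      (hKm.pow_const _).mul (hHm.pow_const _)
    refine (setLIntegral_comp_sub_le (T := closedBall 0 (3 * r)) measurableSet_closedBall
      measurableSet_closedBall w (fun x hx => ?_) hGm).trans ?_
    · rw [mem_closedBall_zero_iff]
      have e₁ := mem_closedBall.1 hx
      have e₂ := mem_closedBall'.1 hw'.1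
      rw [← dist_eq_norm]
      linarith [dist_triangle x c.1 w.1]
    calc ∫⁻ x in closedBall (0 : EuclideanSpace ℝ (Fin n)) (3 * r),
          ∫⁻ y : EuclideanSpace ℝ (Fin m), ENNReal.ofReal (flagKernel n m α β ρ x y) ^ q *
            ENNReal.ofReal (1 + (‖x‖ / r) ^ (α - n)) ^ (1 - q)
        ≤ ∫⁻ x in closedBall (0 : EuclideanSpace ℝ (Fin n)) (3 * r),
            C₂ * (ENNReal.ofReal (r ^ (-σ)) * ENNReal.ofReal (‖x‖ ^ (-n + σ))) := by
          refine lintegral_mono fun x => ?_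
          rcases eq_or_ne x 0 with rfl | hx
          · simp [flagKernel_zero_left hαn, hq0]
          have hx' : 0 < ‖x‖ := norm_pos_iff.2 hx
          have hk : 0 < (‖x‖ / r) ^ (α - n) := by positivity
          rw [lintegral_mul_const' _ _ (by
            rw [ofReal_rpow_one_sub (by positivity)]; exact ENNReal.ofReal_ne_top),
            ofReal_rpow_one_sub (by positivity)]
          refine (mul_le_mul (h₂ x) (ENNReal.ofReal_le_ofReal
            (Real.rpow_le_rpow_of_nonpos hk (le_add_of_nonneg_left zero_le_one)
            (by linarith))) zero_le zero_le).trans_eq ?_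
          rw [← Real.rpow_mul (by positivity), ← hσ, Real.div_rpow hx'.le hr.le, mul_assoc,
            ← ENNReal.ofReal_mul (by positivity), ← ENNReal.ofReal_mul (by positivity),
            Real.rpow_add hx', Real.rpow_neg hr.le]
          congr 2
          ring
      _ ≤ C₂ * (ENNReal.ofReal (r ^ (-σ)) *
            (C₃ * ENNReal.ofReal ((3 * r) ^ (-n + σ + n)))) := by
          rw [lintegral_const_mul _ (by fun_prop), lintegral_const_mul _ (by fun_prop)]
          gcongr
          exact h₃ _ (by positivity)
      _ = B := by
          rw [mul_left_comm _ C₃, ← ENNReal.ofReal_mul (by positivity), neg_add_cancel_comm,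
            Real.mul_rpow (by norm_num) hr.le, mul_left_comm (r ^ (-σ)), ← Real.rpow_add hr,
            neg_add_cancel, Real.rpow_zero, mul_one, hB]
  · refine le_trans (lintegral_mono fun w => ?_) (hAle 0)
    refine le_mul_of_one_le_right zero_le ?_
    rw [ENNReal.one_le_ofReal]
    have : 0 ≤ (‖(0 - w).1‖ / r) ^ (α - n) := by positivity
    linarith

lemma exists_lintegral_rpow_mul_one_add_rpow_le (hm : 0 < m) {δ q : ℝ} (hδ : -(m : ℝ) < δ)
    (hδ0 : δ < 0) (hq : 1 < q) (hδq : δ * q < -(m : ℝ)) :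
    ∃ C : ENNReal, C ≠ ⊤ ∧ ∀ r : ℝ, 0 < r →
      ∫⁻ y : EuclideanSpace ℝ (Fin m),
        ENNReal.ofReal (‖y‖ ^ (δ * q) * (1 + (‖y‖ / r) ^ δ) ^ (1 - q))
        ≤ C * ENNReal.ofReal (r ^ (δ * q + m)) := by
  obtain ⟨C₁, hC₁, h₁⟩ := exists_lintegral_closedBall_norm_rpow_le
    (volume : Measure (EuclideanSpace ℝ (Fin m))) (by simpa using hm) (s := δ) (by simpa using hδ)
  obtain ⟨C₂, hC₂, h₂⟩ := exists_lintegral_compl_closedBall_norm_rpow_le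
    (volume : Measure (EuclideanSpace ℝ (Fin m))) (s := δ * q) (by simpa using hδq)
  simp only [finrank_euclideanSpace_fin] at h₁ h₂
  refine ⟨C₁ + C₂, ENNReal.add_ne_top.2 ⟨hC₁, hC₂⟩, fun r hr => ?_⟩
  rw [← lintegral_add_compl _ (measurableSet_closedBall (x := (0 : EuclideanSpace ℝ (Fin m)))
    (ε := r)), add_mul]
  refine add_le_add ?_ ?_
  · calc ∫⁻ y in closedBall (0 : EuclideanSpace ℝ (Fin m)) r,
          ENNReal.ofReal (‖y‖ ^ (δ * q) * (1 + (‖y‖ / r) ^ δ) ^ (1 - q))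
        ≤ ∫⁻ y in closedBall (0 : EuclideanSpace ℝ (Fin m)) r,
          ENNReal.ofReal (r ^ (-(δ * (1 - q)))) * ENNReal.ofReal (‖y‖ ^ δ) := by
          refine lintegral_mono fun y => ?_
          rcases eq_or_ne y 0 with rfl | hy
          · rw [norm_zero, Real.zero_rpow (by nlinarith), zero_mul, ENNReal.ofReal_zero]
            exact zero_le
          have hy' : 0 < ‖y‖ := norm_pos_iff.2 hy
          rw [← ENNReal.ofReal_mul (by positivity)]
          refine ENNReal.ofReal_le_ofReal ?_
          have hk : 0 < (‖y‖ / r) ^ δ := by positivity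
          calc ‖y‖ ^ (δ * q) * (1 + (‖y‖ / r) ^ δ) ^ (1 - q)
              ≤ ‖y‖ ^ (δ * q) * ((‖y‖ / r) ^ δ) ^ (1 - q) :=
                mul_le_mul_of_nonneg_left (Real.rpow_le_rpow_of_nonpos hk
                  (le_add_of_nonneg_left zero_le_one) (by linarith)) (by positivity)
            _ = r ^ (-(δ * (1 - q))) * ‖y‖ ^ δ := by
                rw [← Real.rpow_mul (by positivity), Real.div_rpow hy'.le hr.le,
                  Real.rpow_neg hr.le, inv_mul_eq_div, ← mul_div_assoc, ← Real.rpow_add hy']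
                congr 2
                ring
      _ ≤ ENNReal.ofReal (r ^ (-(δ * (1 - q)))) * (C₁ * ENNReal.ofReal (r ^ (δ + m))) := by
          rw [lintegral_const_mul _ (by fun_prop)]
          gcongr
          exact h₁ r hr
      _ = C₁ * ENNReal.ofReal (r ^ (δ * q + m)) := by
          rw [mul_left_comm, ← ENNReal.ofReal_mul (by positivity), ← Real.rpow_add hr]
          ring_nf
  · refine (lintegral_mono fun y => ENNReal.ofReal_le_ofReal ?_).trans (h₂ r hr)
    refine mul_le_of_le_one_right (by positivity) ?_
    refine Real.rpow_le_one_of_one_le_of_nonpos ?_ (by linarith)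
    have : 0 ≤ (‖y‖ / r) ^ δ := by positivity
    linarith

/-- Estimate close to the support in the first variable, when the support is short in the first
variable relative to the scale of the kernel. -/
lemma exists_lintegral_near_anisotropic_le (hn : 0 < n) (hm : 0 < m) (hβ : 0 < β) (hβm : β < m)
    {q : ℝ} (hq : 1 < q) (hαq : -(n : ℝ) < (α - n) * q) (hβq : (β - m) * q < -(m : ℝ))
    (hhom : (α - n) * q + ρ * ((β - m) * q + m) = -n) {M : ℝ} (hM : 0 ≤ M) :
    ∃ C : ENNReal, C ≠ ⊤ ∧ ∀ (c : EuclideanSpace ℝ (Fin n) × EuclideanSpace ℝ (Fin m)) (r t : ℝ)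
      (b : EuclideanSpace ℝ (Fin n) × EuclideanSpace ℝ (Fin m) → ENNReal), 0 < r → 0 < t →
      r ≤ t → t ^ ρ = r → Measurable b →
      (∀ w, b w ≤ ENNReal.ofReal (M * (r ^ (n + m))⁻¹)) →
      (∀ w, b w ≠ 0 → w ∈ closedBall c.1 r ×ˢ closedBall c.2 r) →
      ∫⁻ z in Prod.fst ⁻¹' closedBall c.1 (2 * t),
        (∫⁻ w, b w * ENNReal.ofReal (flagKernel n m α β ρ (z - w).1 (z - w).2)) ^ q ≤ C := by
  have hq0 : 0 < q := by linarith
  obtain ⟨C₁, hC₁, h₁⟩ := exists_lintegral_closedBall_one_add_rpow_le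
    (volume : Measure (EuclideanSpace ℝ (Fin m))) (by simpa using hm) (s := β - m)
    (by simp; linarith) (by linarith)
  obtain ⟨C₂, hC₂, h₂⟩ := exists_lintegral_rpow_mul_one_add_rpow_le hm (δ := β - m) (by linarith)
    (by linarith) hq hβq
  obtain ⟨C₃, hC₃, h₃⟩ := exists_lintegral_closedBall_norm_rpow_le
    (volume : Measure (EuclideanSpace ℝ (Fin n))) (by simpa using hn) (s := (α - n) * q)
    (by simpa using hαq)
  simp only [finrank_euclideanSpace_fin] at h₁ h₃
  have hne : Nonempty (Fin m) := ⟨⟨0, hm⟩⟩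
  set V := volume (ball (0 : EuclideanSpace ℝ (Fin n)) 1) with hV
  have hVt : V ≠ ⊤ := measure_ball_lt_top.ne
  set A := ENNReal.ofReal M * (V * C₁) with hA
  have hAt : A ≠ ⊤ := ENNReal.mul_ne_top ENNReal.ofReal_ne_top (ENNReal.mul_ne_top hVt hC₁)
  set B := C₂ * (C₃ * ENNReal.ofReal (3 ^ ((α - n) * q + n))) with hB
  have hBt : B ≠ ⊤ := ENNReal.mul_ne_top hC₂ (ENNReal.mul_ne_top hC₃ ENNReal.ofReal_ne_top)
  refine ⟨A ^ (q - 1) * (A * B), ENNReal.mul_ne_top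
    (ENNReal.rpow_ne_top_of_nonneg (by linarith) hAt) (ENNReal.mul_ne_top hAt hBt),
    fun c r t b hr ht hrt htr hbm hb hsupp => ?_⟩
  have hHm : Measurable fun z : EuclideanSpace ℝ (Fin n) × EuclideanSpace ℝ (Fin m) =>
      ENNReal.ofReal (1 + (‖z.2‖ / r) ^ (β - m)) := by fun_prop
  have hKm : Measurable fun z : EuclideanSpace ℝ (Fin n) × EuclideanSpace ℝ (Fin m) =>
      ENNReal.ofReal (flagKernel n m α β ρ z.1 z.2) := measurable_flagKernel.ennreal_ofReal
  have hAle (z : EuclideanSpace ℝ (Fin n) × EuclideanSpace ℝ (Fin m)) :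
      ∫⁻ w, b w * ENNReal.ofReal (1 + (‖(z - w).2‖ / r) ^ (β - m)) ≤ A := by
    have := lintegral_mul_prod_le hM hr hb hsupp (G := fun _ => 1)
      (G' := fun v => ENNReal.ofReal (1 + (‖z.2 - v‖ / r) ^ (β - m)))
      (by fun_prop) (by fun_prop) (setLIntegral_one_closedBall_le hn hr c.1) (h₁ r hr c.2 z.2)
    simpa using this
  refine setLIntegral_rpow_lintegral_mul_le volume volume hq hbm (measurable_comp_sub hKm)
    (measurable_comp_sub hHm) (fun z w => ?_) (fun z w => ENNReal.ofReal_ne_top) hAle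
    (fun w hw => ?_) ?_
  · exact (ENNReal.ofReal_pos.2 (by positivity)).ne'
  · have hw' := hsupp w hw
    have hGm : Measurable fun z : EuclideanSpace ℝ (Fin n) × EuclideanSpace ℝ (Fin m) =>
      ENNReal.ofReal (flagKernel n m α β ρ z.1 z.2) ^ q *
        ENNReal.ofReal (1 + (‖z.2‖ / r) ^ (β - m)) ^ (1 - q) :=
      (hKm.pow_const _).mul (hHm.pow_const _)
    refine (setLIntegral_comp_sub_le (T := closedBall 0 (3 * t)) measurableSet_closedBall
      measurableSet_closedBall w (fun x hx => ?_) hGm).trans ?_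
    · rw [mem_closedBall_zero_iff]
      have e₁ := mem_closedBall.1 hx
      have e₂ := mem_closedBall'.1 hw'.1
      rw [← dist_eq_norm]
      linarith [dist_triangle x c.1 w.1]
    calc ∫⁻ x in closedBall (0 : EuclideanSpace ℝ (Fin n)) (3 * t),
          ∫⁻ y : EuclideanSpace ℝ (Fin m), ENNReal.ofReal (flagKernel n m α β ρ x y) ^ q *
            ENNReal.ofReal (1 + (‖y‖ / r) ^ (β - m)) ^ (1 - q)
        ≤ ∫⁻ x in closedBall (0 : EuclideanSpace ℝ (Fin n)) (3 * t),
            ENNReal.ofReal (‖x‖ ^ ((α - n) * q)) *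
              (C₂ * ENNReal.ofReal (r ^ ((β - m) * q + m))) := by
          refine lintegral_mono fun x => ?_
          refine le_trans ?_ (mul_le_mul_right (h₂ r hr) _)
          rw [← lintegral_const_mul _ (by fun_prop)]
          have hae : ∀ᵐ y : EuclideanSpace ℝ (Fin m), y ≠ 0 := by
            simp [ae_iff]
          refine lintegral_mono_ae ?_
          filter_upwards [hae] with y hy
          have hy' : 0 < ‖y‖ := norm_pos_iff.2 hy
          have hk : 0 ≤ (‖y‖ / r) ^ (β - m) := by positivity
          rw [ofReal_rpow_one_sub (by positivity),
            ENNReal.ofReal_rpow_of_nonneg (flagKernel_nonneg _ _) hq0.le,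
            ← ENNReal.ofReal_mul (Real.rpow_nonneg (flagKernel_nonneg _ _) _),
            ← ENNReal.ofReal_mul (by positivity), ← mul_assoc, Real.rpow_mul (norm_nonneg x),
            Real.rpow_mul (norm_nonneg y), ← Real.mul_rpow (by positivity) (by positivity)]
          refine ENNReal.ofReal_le_ofReal (mul_le_mul_of_nonneg_right
            (Real.rpow_le_rpow (flagKernel_nonneg _ _) ?_ hq0.le) (by positivity))
          refine mul_le_mul_of_nonneg_left (Real.rpow_le_rpow_of_nonpos hy' ?_ (by linarith))
            (by positivity)
          have : 0 ≤ ‖x‖ ^ ρ := by positivity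
          linarith
      _ ≤ C₃ * ENNReal.ofReal ((3 * t) ^ ((α - n) * q + n)) *
            (C₂ * ENNReal.ofReal (r ^ ((β - m) * q + m))) := by
          rw [lintegral_mul_const _ (by fun_prop)]
          gcongr
          exact h₃ _ (by positivity)
      _ = C₂ * (C₃ * ENNReal.ofReal ((3 * t) ^ ((α - n) * q + n) * r ^ ((β - m) * q + m))) := by
          rw [ENNReal.ofReal_mul (by positivity)]
          ring
      _ = B := by
          rw [← htr, Real.mul_rpow (by norm_num) ht.le, mul_assoc, ← Real.rpow_mul ht.le,
            ← Real.rpow_add ht]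
          have : (α - n) * q + n + ρ * ((β - m) * q + m) = 0 := by linarith
          rw [this, Real.rpow_zero, mul_one]
  · refine le_trans (lintegral_mono fun w => ?_) (hAle 0)
    refine le_mul_of_one_le_right zero_le ?_
    rw [ENNReal.one_le_ofReal]
    have : 0 ≤ (‖(0 - w).2‖ / r) ^ (β - m) := by positivity
    linarith

/-- The far estimate for a point mass. -/
lemma exists_lintegral_flagKernel_sub_rpow_le (hαn : α < n) (hρ : 1 ≤ ρ)
    {q : ℝ} (hq0 : 0 < q) (hβq : (β - m) * q < -(m : ℝ))
    (hhom : (α - n) * q + ρ * ((β - m) * q + m) = -n) :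
    ∃ C : ENNReal, C ≠ ⊤ ∧ ∀ (c w : EuclideanSpace ℝ (Fin n) × EuclideanSpace ℝ (Fin m)) (r t : ℝ),
      0 < t → r ≤ t → r ≤ t ^ ρ → w ∈ closedBall c.1 r ×ˢ closedBall c.2 r →
      ∫⁻ z in Prod.fst ⁻¹' (closedBall c.1 (2 * t))ᶜ,
        ENNReal.ofReal |flagKernel n m α β ρ (z - w).1 (z - w).2
          - flagKernel n m α β ρ (z - c).1 (z - c).2| ^ q ≤ C := by
  obtain ⟨C₁, hC₁, h₁⟩ := exists_abs_flagKernel_sub_le n m α β hρ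
  obtain ⟨C₂, hC₂, h₂⟩ := exists_lintegral_flagKernel_rpow_le (n := n) (m := m) (α := α) hq0 hβq
    hαn hhom
  obtain ⟨C₃, hC₃, h₃⟩ := exists_lintegral_compl_closedBall_norm_rpow_le
    (volume : Measure (EuclideanSpace ℝ (Fin n))) (s := -q + -n) (by simp; linarith)
  simp only [finrank_euclideanSpace_fin] at h₃
  refine ⟨C₂ * (C₃ * ENNReal.ofReal (C₁ ^ q * 2 ^ (-q))), ENNReal.mul_ne_top hC₂
    (ENNReal.mul_ne_top hC₃ ENNReal.ofReal_ne_top), fun c w r t ht hrt htr hw' => ?_⟩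
  have hGm : Measurable fun z : EuclideanSpace ℝ (Fin n) × EuclideanSpace ℝ (Fin m) =>
      ENNReal.ofReal (C₁ * (t / ‖z.1‖)) ^ q * ENNReal.ofReal (flagKernel n m α β ρ z.1 z.2) ^ q :=
    Measurable.mul (by fun_prop) (measurable_flagKernel.ennreal_ofReal.pow_const _)
  have key : ∫⁻ z in Prod.fst ⁻¹' (closedBall c.1 (2 * t))ᶜ,
        ENNReal.ofReal |flagKernel n m α β ρ (z - w).1 (z - w).2
          - flagKernel n m α β ρ (z - c).1 (z - c).2| ^ q
      ≤ ∫⁻ z in Prod.fst ⁻¹' (closedBall c.1 (2 * t))ᶜ,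
        ENNReal.ofReal (C₁ * (t / ‖(z - c).1‖)) ^ q
          * ENNReal.ofReal (flagKernel n m α β ρ (z - c).1 (z - c).2) ^ q := by
        refine setLIntegral_mono' (measurable_fst measurableSet_closedBall.compl) fun z hz => ?_
        rw [← ENNReal.mul_rpow_of_nonneg _ _ hq0.le,
          ← ENNReal.ofReal_mul (by positivity)]
        refine ENNReal.rpow_le_rpow (ENNReal.ofReal_le_ofReal ?_) hq0.le
        have := h₁ t (z - c).1 (w - c).1 (z - c).2 (w - c).2 ht
          ((mem_closedBall_iff_norm.1 hw'.1).trans hrt)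
          ((mem_closedBall_iff_norm.1 hw'.2).trans htr)
          (by simpa [dist_eq_norm] using hz)
        rw [← Prod.fst_sub, ← Prod.snd_sub, sub_sub_sub_cancel_right, ← mul_assoc] at this
        exact this
  refine key.trans ?_
  have e1 : ∫⁻ z in Prod.fst ⁻¹' (closedBall c.1 (2 * t))ᶜ,
        ENNReal.ofReal (C₁ * (t / ‖(z - c).1‖)) ^ q
          * ENNReal.ofReal (flagKernel n m α β ρ (z - c).1 (z - c).2) ^ q
      ≤ ∫⁻ x in (closedBall (0 : EuclideanSpace ℝ (Fin n)) (2 * t))ᶜ,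
          ∫⁻ y : EuclideanSpace ℝ (Fin m),
          ENNReal.ofReal (C₁ * (t / ‖x‖)) ^ q * ENNReal.ofReal (flagKernel n m α β ρ x y) ^ q :=
        setLIntegral_comp_sub_le measurableSet_closedBall.compl measurableSet_closedBall.compl c
          (fun x hx => by simpa [dist_eq_norm] using hx) hGm
  have e2 : ∫⁻ x in (closedBall (0 : EuclideanSpace ℝ (Fin n)) (2 * t))ᶜ,
          ∫⁻ y : EuclideanSpace ℝ (Fin m),
          ENNReal.ofReal (C₁ * (t / ‖x‖)) ^ q * ENNReal.ofReal (flagKernel n m α β ρ x y) ^ q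
      ≤ ∫⁻ x in (closedBall (0 : EuclideanSpace ℝ (Fin n)) (2 * t))ᶜ,
          C₂ * (ENNReal.ofReal (C₁ ^ q * t ^ q) * ENNReal.ofReal (‖x‖ ^ (-q + -n))) := by
        refine setLIntegral_mono' measurableSet_closedBall.compl fun x hx => ?_
        have hx' : 0 < ‖x‖ := by
          simp at hx
          linarith
        rw [lintegral_const_mul' _ _ (ENNReal.rpow_ne_top_of_nonneg hq0.le ENNReal.ofReal_ne_top)]
        refine (mul_le_mul_right (h₂ x) _).trans_eq ?_
        rw [mul_left_comm, ENNReal.ofReal_rpow_of_nonneg (by positivity) hq0.le,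
          ← ENNReal.ofReal_mul (by positivity), ← ENNReal.ofReal_mul (by positivity),
          Real.mul_rpow hC₁ (by positivity), Real.div_rpow ht.le hx'.le, Real.rpow_add hx',
          Real.rpow_neg hx'.le q]
        congr 2
        ring
  have e3 : ∫⁻ x in (closedBall (0 : EuclideanSpace ℝ (Fin n)) (2 * t))ᶜ,
          C₂ * (ENNReal.ofReal (C₁ ^ q * t ^ q) * ENNReal.ofReal (‖x‖ ^ (-q + -n)))
      ≤ C₂ * (ENNReal.ofReal (C₁ ^ q * t ^ q)
          * (C₃ * ENNReal.ofReal ((2 * t) ^ (-q + -n + n)))) := by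
        rw [lintegral_const_mul _ (by fun_prop), lintegral_const_mul _ (by fun_prop)]
        gcongr
        exact h₃ _ (by positivity)
  have e4 : C₂ * (ENNReal.ofReal (C₁ ^ q * t ^ q)
          * (C₃ * ENNReal.ofReal ((2 * t) ^ (-q + -n + n))))
      = C₂ * (C₃ * ENNReal.ofReal (C₁ ^ q * 2 ^ (-q))) := by
        rw [mul_left_comm _ C₃, ← ENNReal.ofReal_mul (by positivity), neg_add_cancel_right,
          Real.mul_rpow (by norm_num) ht.le, mul_mul_mul_comm, ← Real.rpow_add ht,
          add_neg_cancel, Real.rpow_zero, mul_one]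
  exact e1.trans (e2.trans (e3.trans_eq e4))

/-- Estimate away from the support in the first variable, with cancellation. -/
lemma exists_lintegral_far_le (hn : 0 < n) (hm : 0 < m) (hαn : α < n) (hρ : 1 ≤ ρ)
    {q : ℝ} (hq : 1 < q) (hβq : (β - m) * q < -(m : ℝ))
    (hhom : (α - n) * q + ρ * ((β - m) * q + m) = -n) {M : ℝ} (hM : 0 ≤ M) :
    ∃ C : ENNReal, C ≠ ⊤ ∧ ∀ (c : EuclideanSpace ℝ (Fin n) × EuclideanSpace ℝ (Fin m)) (r t : ℝ)
      (b : EuclideanSpace ℝ (Fin n) × EuclideanSpace ℝ (Fin m) → ENNReal), 0 < r → 0 < t →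
      r ≤ t → r ≤ t ^ ρ → Measurable b →
      (∀ w, b w ≤ ENNReal.ofReal (M * (r ^ (n + m))⁻¹)) →
      (∀ w, b w ≠ 0 → w ∈ closedBall c.1 r ×ˢ closedBall c.2 r) →
      ∫⁻ z in Prod.fst ⁻¹' (closedBall c.1 (2 * t))ᶜ,
        (∫⁻ w, b w * ENNReal.ofReal |flagKernel n m α β ρ (z - w).1 (z - w).2
          - flagKernel n m α β ρ (z - c).1 (z - c).2|) ^ q ≤ C := by
  have hq0 : 0 < q := by linarith
  obtain ⟨B, hBt, h₁⟩ := exists_lintegral_flagKernel_sub_rpow_le (m := m) hαn hρ hq0 hβq hhom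
  set V := volume (ball (0 : EuclideanSpace ℝ (Fin n)) 1) with hV
  have hVt : V ≠ ⊤ := measure_ball_lt_top.ne
  set V' := volume (ball (0 : EuclideanSpace ℝ (Fin m)) 1) with hV'
  have hVt' : V' ≠ ⊤ := measure_ball_lt_top.ne
  set A := ENNReal.ofReal M * (V * V') with hA
  have hAt : A ≠ ⊤ := ENNReal.mul_ne_top ENNReal.ofReal_ne_top (ENNReal.mul_ne_top hVt hVt')
  refine ⟨A ^ (q - 1) * (A * B), ENNReal.mul_ne_top
    (ENNReal.rpow_ne_top_of_nonneg (by linarith) hAt) (ENNReal.mul_ne_top hAt hBt),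
    fun c r t b hr ht hrt htr hbm hb hsupp => ?_⟩
  have hAle : ∫⁻ w, b w ≤ A := by
    have := lintegral_mul_prod_le hM hr hb hsupp (G := fun _ => 1) (G' := fun _ => 1)
      (by fun_prop) (by fun_prop) (setLIntegral_one_closedBall_le hn hr c.1)
      (setLIntegral_one_closedBall_le hm hr c.2)
    simpa using this
  have hFm : Measurable (Function.uncurry
      fun z w : EuclideanSpace ℝ (Fin n) × EuclideanSpace ℝ (Fin m) =>
      ENNReal.ofReal |flagKernel n m α β ρ (z - w).1 (z - w).2
          - flagKernel n m α β ρ (z - c).1 (z - c).2|) := by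
    have e₁ := measurable_comp_sub (measurable_flagKernel (n := n) (m := m) (α := α) (β := β)
      (ρ := ρ))
    have e₂ : Measurable fun p : (EuclideanSpace ℝ (Fin n) × EuclideanSpace ℝ (Fin m)) ×
        (EuclideanSpace ℝ (Fin n) × EuclideanSpace ℝ (Fin m)) =>
        flagKernel n m α β ρ (p.1 - c).1 (p.1 - c).2 :=
      measurable_flagKernel.comp (measurable_fst.sub_const c)
    exact (e₁.sub e₂).abs.ennreal_ofReal
  refine setLIntegral_rpow_lintegral_mul_le volume volume hq hbm (H := fun _ _ => 1) hFm
    measurable_const (fun _ _ => one_ne_zero) (fun _ _ => ENNReal.one_ne_top)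
    (fun z => by simpa using hAle) (fun w hw => ?_) hAle
  simpa using h₁ c w r t ht hrt htr (hsupp w hw)

lemma norm_le_of_forall_abs_le {d : ℕ} {r : ℝ} (hr : 0 ≤ r) {x : EuclideanSpace ℝ (Fin d)}
    (hx : ∀ i, |x i| ≤ r) : ‖x‖ ≤ d * r := by
  rw [EuclideanSpace.norm_eq]
  refine Real.sqrt_le_iff.2 ⟨by positivity, ?_⟩
  calc ∑ i, ‖x i‖ ^ 2 ≤ ∑ _i : Fin d, r ^ 2 := by
        gcongr with i
        exact hx i
    _ = d * r ^ 2 := by simp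
    _ ≤ (d * r) ^ 2 := by
        rw [mul_pow]
        gcongr
        exact_mod_cast Nat.le_self_pow two_ne_zero d

/-- An atom is supported in a product of balls whose radius is comparable to the side of its
cube. -/
lemma IsH1Atom.exists_ball_bound (hn : 0 < n)
    {a : EuclideanSpace ℝ (Fin n) × EuclideanSpace ℝ (Fin m) → ℝ} (ha : IsH1Atom n m a) :
    ∃ (c : EuclideanSpace ℝ (Fin n) × EuclideanSpace ℝ (Fin m)) (r : ℝ), 0 < r ∧
      (∀ w, ‖a w‖ₑ ≤ ENNReal.ofReal ((((n : ℝ) + m) / 2) ^ (n + m) * (r ^ (n + m))⁻¹)) ∧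
      ∀ w, ‖a w‖ₑ ≠ 0 → w ∈ closedBall c.1 r ×ˢ closedBall c.2 r := by
  obtain ⟨-, c, r, hr, hsupp, hbd, -⟩ := ha
  have hn' : (0 : ℝ) < n := by exact_mod_cast hn
  have hK : (0 : ℝ) < n + m := by positivity
  refine ⟨c, (n + m) * r, by positivity, fun w => ?_, fun w hw => ?_⟩
  · rw [Real.enorm_eq_ofReal_abs]
    refine ENNReal.ofReal_le_ofReal ((hbd w).trans_eq ?_)
    rw [← inv_pow, ← inv_pow, ← mul_pow]
    congr 1
    field_simp
  · obtain ⟨h₁, h₂⟩ := hsupp w (by simpa using hw)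
    refine ⟨mem_closedBall_iff_norm.2 ?_, mem_closedBall_iff_norm.2 ?_⟩
    · refine (norm_le_of_forall_abs_le hr.le (x := w.1 - c.1) (by simpa using h₁)).trans ?_
      gcongr
      linarith [(Nat.cast_nonneg m : (0 : ℝ) ≤ m)]
    · refine (norm_le_of_forall_abs_le hr.le (x := w.2 - c.2) (by simpa using h₂)).trans ?_
      gcongr
      linarith

lemma enorm_flagOp_le (a : EuclideanSpace ℝ (Fin n) × EuclideanSpace ℝ (Fin m) → ℝ)
    (z : EuclideanSpace ℝ (Fin n) × EuclideanSpace ℝ (Fin m)) :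
    ‖flagOp n m α β ρ a z‖ₑ
      ≤ ∫⁻ w, ‖a w‖ₑ * ENNReal.ofReal (flagKernel n m α β ρ (z - w).1 (z - w).2) := by
  refine (enorm_integral_le_lintegral_enorm _).trans_eq (lintegral_congr fun w => ?_)
  rw [enorm_mul, Real.enorm_eq_ofReal (flagKernel_nonneg _ _)]
  rfl

lemma enorm_flagOp_le_of_integral_eq_zero
    {a : EuclideanSpace ℝ (Fin n) × EuclideanSpace ℝ (Fin m) → ℝ} (ha : Integrable a)
    (ha₀ : ∫ w, a w = 0) (z c : EuclideanSpace ℝ (Fin n) × EuclideanSpace ℝ (Fin m)) :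
    ‖flagOp n m α β ρ a z‖ₑ
      ≤ ∫⁻ w, ‖a w‖ₑ * ENNReal.ofReal |flagKernel n m α β ρ (z - w).1 (z - w).2
          - flagKernel n m α β ρ (z - c).1 (z - c).2| := by
  by_cases hI : Integrable fun w => a w * flagKernel n m α β ρ (z - w).1 (z - w).2
  · have : flagOp n m α β ρ a z = ∫ w, a w * (flagKernel n m α β ρ (z - w).1 (z - w).2
          - flagKernel n m α β ρ (z - c).1 (z - c).2) := by
      simp_rw [mul_sub]
      rw [integral_sub hI (ha.mul_const _), integral_mul_const, ha₀, zero_mul, sub_zero]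
      rfl
    rw [this]
    refine (enorm_integral_le_lintegral_enorm _).trans_eq (lintegral_congr fun w => ?_)
    rw [enorm_mul, Real.enorm_eq_ofReal_abs (_ - _)]
  · rw [show flagOp n m α β ρ a z = 0 from integral_undef hI, enorm_zero]
    exact zero_le

/-- The homogeneity condition at the level of the exponents of the kernel. -/
lemma flagKernel_exponents (hn : 0 < n) (hm : 0 < m) (hρ : 1 ≤ ρ) {q : ℝ} (hq : 1 < q)
    (hmain : β / m < α / n) (hhom : (α + ρ * β) / (n + ρ * m) = 1 - 1 / q) :
    (α - n) * q + ρ * ((β - m) * q + m) = -n ∧ (β - m) * q < -(m : ℝ)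
      ∧ -(n : ℝ) < (α - n) * q := by
  have hn' : (0 : ℝ) < n := by exact_mod_cast hn
  have hm' : (0 : ℝ) < m := by exact_mod_cast hm
  have hq0 : 0 < q := by linarith
  have hρ0 : 0 < ρ := by linarith
  rw [div_lt_div_iff₀ hm' hn'] at hmain
  have hN : 0 < (n : ℝ) + ρ * m := by positivity
  rw [one_sub_div hq0.ne', div_eq_div_iff hN.ne' hq0.ne'] at hhom
  refine ⟨by linarith, ?_, ?_⟩
  · have h : (β * q - m * (q - 1)) * (n + ρ * m) < 0 := by
      have : (β * q - m * (q - 1)) * (n + ρ * m) = q * (β * n - α * m) := by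
        linear_combination (m : ℝ) * hhom
      rw [this]
      exact mul_neg_of_pos_of_neg hq0 (by linarith)
    have := neg_of_mul_neg_left h hN.le
    linarith
  · have h : 0 < (α * q - n * (q - 1)) * (n + ρ * m) := by
      have : (α * q - n * (q - 1)) * (n + ρ * m) = ρ * q * (α * m - β * n) := by
        linear_combination (n : ℝ) * hhom
      rw [this]
      exact mul_pos (by positivity) (by linarith)
    have := pos_of_mul_pos_left h hN.le
    linarith

end Kernel

/-- Theorem Two (sufficiency): if `α/n > β/m` and `(α+ρβ)/(n+ρm) = 1 - 1/q`,
then `‖I a‖_{L^q}` is bounded by a constant uniformly over all `H¹`-atoms `a`. -/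
theorem flagOp_atom_bound (n m : ℕ) (hn : 0 < n) (hm : 0 < m) (α β ρ q : ℝ)
    (hα : 0 < α) (hαn : α < n) (hβ : 0 < β) (hβm : β < m) (hρ : 1 ≤ ρ)
    (hq : 1 < q)
    (hmain : β / m < α / n)
    (hhom : (α + ρ * β) / (n + ρ * m) = 1 - 1 / q) :
    ∃ C : ℝ, 0 < C ∧
      ∀ a : EuclideanSpace ℝ (Fin n) × EuclideanSpace ℝ (Fin m) → ℝ,
        IsH1Atom n m a →
        eLpNorm (flagOp n m α β ρ a) (ENNReal.ofReal q) volume ≤ ENNReal.ofReal C := by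
  obtain ⟨hhom', hβq, hαq⟩ := flagKernel_exponents hn hm hρ hq hmain hhom
  have hq0 : 0 < q := by linarith
  have hρ0 : 0 < ρ := by linarith
  have hM : (0 : ℝ) ≤ (((n : ℝ) + m) / 2) ^ (n + m) := by positivity
  obtain ⟨C₁, hC₁, h₁⟩ := exists_lintegral_near_le hn hm hα hαn hq hβq hhom' hM
  obtain ⟨C₂, hC₂, h₂⟩ :=
    exists_lintegral_near_anisotropic_le hn hm hβ hβm hq hαq hβq hhom' hM
  obtain ⟨C₃, hC₃, h₃⟩ := exists_lintegral_far_le hn hm hαn hρ hq hβq hhom' hM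
  set C := (C₁ + C₂ + C₃) ^ (1 / q) with hC
  have hCt : C ≠ ⊤ := ENNReal.rpow_ne_top_of_nonneg (by positivity)
    (ENNReal.add_ne_top.2 ⟨ENNReal.add_ne_top.2 ⟨hC₁, hC₂⟩, hC₃⟩)
  refine ⟨C.toReal + 1, by positivity, fun a ha => ?_⟩
  obtain ⟨c, r, hr, hbd, hsupp⟩ := ha.exists_ball_bound hn
  have ham : Measurable fun w => ‖a w‖ₑ := ha.1.enorm
  have haI : Integrable a := by
    refine ⟨ha.1.aestronglyMeasurable, ?_⟩
    have := lintegral_mul_prod_le hM hr hbd hsupp (G := fun _ => 1) (G' := fun _ => 1)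
      (by fun_prop) (by fun_prop) (setLIntegral_one_closedBall_le hn hr c.1)
      (setLIntegral_one_closedBall_le hm hr c.2)
    simp only [mul_one] at this
    exact this.trans_lt (ENNReal.mul_lt_top ENNReal.ofReal_lt_top
      (ENNReal.mul_lt_top measure_ball_lt_top measure_ball_lt_top))
  have ha₀ : ∫ w, a w = 0 := ha.2.choose_spec.choose_spec.2.2.2
  obtain ⟨t, ht, hrt, htr, hnear⟩ : ∃ t : ℝ, 0 < t ∧ r ≤ t ∧ r ≤ t ^ ρ ∧
      ∫⁻ z in Prod.fst ⁻¹' Metric.closedBall c.1 (2 * t),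
        (∫⁻ w, ‖a w‖ₑ * ENNReal.ofReal (flagKernel n m α β ρ (z - w).1 (z - w).2)) ^ q
        ≤ C₁ + C₂ := by
    rcases le_total 1 r with h | h
    · exact ⟨r, hr, le_rfl, Real.self_le_rpow_of_one_le h hρ,
        (h₁ c r _ hr ham hbd hsupp).trans le_self_add⟩
    · have e : (r ^ (1 / ρ)) ^ ρ = r := by
        rw [← Real.rpow_mul hr.le, one_div_mul_cancel hρ0.ne', Real.rpow_one]
      have hrt : r ≤ r ^ (1 / ρ) :=
        Real.self_le_rpow_of_le_one hr.le h ((div_le_one hρ0).2 hρ)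
      exact ⟨r ^ (1 / ρ), by positivity, hrt, e.ge,
        (h₂ c r _ _ hr (by positivity) hrt e ham hbd hsupp).trans le_add_self⟩
  have hfar := h₃ c r t _ hr ht hrt htr ham hbd hsupp
  have hint : ∫⁻ z, ‖flagOp n m α β ρ a z‖ₑ ^ q ≤ C₁ + C₂ + C₃ := by
    rw [← lintegral_add_compl _ (measurable_fst (Metric.isClosed_closedBall.measurableSet :
      MeasurableSet (Metric.closedBall c.1 (2 * t))))]
    refine add_le_add ((lintegral_mono fun z => ?_).trans hnear)
      ((lintegral_mono fun z => ?_).trans hfar)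
    · exact ENNReal.rpow_le_rpow (enorm_flagOp_le a z) hq0.le
    · exact ENNReal.rpow_le_rpow (enorm_flagOp_le_of_integral_eq_zero haI ha₀ z c) hq0.le
  rw [eLpNorm_eq_lintegral_rpow_enorm_toReal (by simpa using hq0) ENNReal.ofReal_ne_top,
    ENNReal.toReal_ofReal hq0.le]
  calc _ ≤ C := ENNReal.rpow_le_rpow hint (by positivity)
    _ = ENNReal.ofReal C.toReal := (ENNReal.ofReal_toReal hCt).symm
    _ ≤ _ := ENNReal.ofReal_le_ofReal (by linarith)
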